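/- Lemma 4.2(iii): let d ≥ 1, λ > 0, E ∈ ℝ, 0 < δ ≤ 1/2, Λ ⊂ ℤ^d a finite cube with nearest-neighbour sites i₁, i₂. Let B = (λ − i(E+Δ))|_{Λ∖{i₁,i₂}}, let d₁, d₂ ∈ ℝ^{Λ∖{i₁,i₂}} be the indicator vectors d₁(j) = 1 if |i₁−j|₁ = 1 (and j ∈ Λ∖{i₁,i₂}), d₂(j) = 1 if |i₂−j|₁ = 1, and zero otherwise, D^T = (d₁, d₂), A₀ = −i(E+Δ)|_{{i₁,i₂}}, and S_{++} = A₀ + λ(1−δ²)·1₂ + D B^{−1} D^T ∈ ℂ^{2×2}. Then Re ⟨f, S_{++} f⟩ ≥ (λ/2)‖f‖² for all f ∈ ℂ², and there exists K > 0 depending only on d and E such that |(S_{++})_{jk}| ≤ K(λ + 1/λ) for all j, k ∈ {1,2}. -/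

import Mathlib

open MeasureTheory Matrix

noncomputable section

/-- ℓ¹ distance on ℤ^d. -/
def dist1 {d : ℕ} (x y : Fin d → ℤ) : ℤ := ∑ i, |x i - y i|

/-- The cube [-L, L]^d in ℤ^d, centered at the origin. -/
def cube (d L : ℕ) : Finset (Fin d → ℤ) :=
  Finset.Icc (fun _ => -(L : ℤ)) (fun _ => (L : ℤ))

/-- Entries of the discrete Laplacian associated to a finite volume Λ. -/
def lapE {d : ℕ} (Λ : Finset (Fin d → ℤ)) (j k : Fin d → ℤ) : ℂ :=
  (if dist1 j k = 1 then 1 else 0) -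
    (if j = k then ((Λ.filter (fun k' => dist1 j k' = 1)).card : ℂ) else 0)

/-- The matrix `B = (λ - i(E+Δ))|_{Λ∖{i₁,i₂}}`. -/
def Bmat {d : ℕ} (Λ : Finset (Fin d → ℤ)) (i₁ i₂ : Fin d → ℤ) (E lam : ℝ) :
    Matrix ((Λ.erase i₁).erase i₂) ((Λ.erase i₁).erase i₂) ℂ := fun j k =>
  (lam : ℂ) * (if j = k then 1 else 0) -
    Complex.I * ((if j = k then (E : ℂ) else 0) + lapE Λ (j : Fin d → ℤ) (k : Fin d → ℤ))

/-- The 2 × |Λ∖{i₁,i₂}| coupling matrix `D`, with rows the indicator vectors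
`d₁(j) = 1_{|i₁-j|₁=1}`, `d₂(j) = 1_{|i₂-j|₁=1}`. -/
def Dmat {d : ℕ} (Λ : Finset (Fin d → ℤ)) (i₁ i₂ : Fin d → ℤ) :
    Matrix (Fin 2) ((Λ.erase i₁).erase i₂) ℂ := fun a k =>
  if dist1 (![i₁, i₂] a) (k : Fin d → ℤ) = 1 then 1 else 0

/-- The block `A₀ = -i(E+Δ)|_{{i₁,i₂}}`. -/
def A0mat {d : ℕ} (Λ : Finset (Fin d → ℤ)) (i₁ i₂ : Fin d → ℤ) (E : ℝ) :
    Matrix (Fin 2) (Fin 2) ℂ := fun a b =>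
  -Complex.I * ((if a = b then (E : ℂ) else 0) + lapE Λ (![i₁, i₂] a) (![i₁, i₂] b))

/-- The Schur complement `S_{++} = A₀ + λ(1-δ²)·1₂ + D B⁻¹ Dᵀ`. -/
def Spp {d : ℕ} (Λ : Finset (Fin d → ℤ)) (i₁ i₂ : Fin d → ℤ) (E lam δ : ℝ) :
    Matrix (Fin 2) (Fin 2) ℂ :=
  A0mat Λ i₁ i₂ E + ((lam : ℂ) * (1 - (δ : ℂ) ^ 2)) • (1 : Matrix (Fin 2) (Fin 2) ℂ) +
    Dmat Λ i₁ i₂ * (Bmat Λ i₁ i₂ E lam)⁻¹ * (Dmat Λ i₁ i₂)ᵀ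

namespace Matrix

variable {n : Type*} [Fintype n]

theorem star_dotProduct_self_eq_sum_norm_sq (v : n → ℂ) :
    star v ⬝ᵥ v = ((∑ i, ‖v i‖ ^ 2 : ℝ) : ℂ) := by
  simp [dotProduct, Complex.conj_mul']

theorem norm_dotProduct_le_sum (u v : n → ℂ) : ‖u ⬝ᵥ v‖ ≤ ∑ i, ‖u i‖ * ‖v i‖ :=
  (norm_sum_le _ _).trans_eq (by simp)

theorem norm_dotProduct_le_of_pos (u v : n → ℂ) {c : ℝ} (hc : 0 < c) :
    ‖u ⬝ᵥ v‖ ≤ (∑ i, ‖u i‖ ^ 2) / (2 * c) + c / 2 * ∑ i, ‖v i‖ ^ 2 := by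
  refine (norm_dotProduct_le_sum u v).trans ?_
  rw [Finset.sum_div, Finset.mul_sum, ← Finset.sum_add_distrib]
  refine Finset.sum_le_sum fun i _ => ?_
  have h : ‖u i‖ ^ 2 / (2 * c) + c / 2 * ‖v i‖ ^ 2 - ‖u i‖ * ‖v i‖ =
      (‖u i‖ - c * ‖v i‖) ^ 2 / (2 * c) := by
    field_simp
    ring
  have : 0 ≤ (‖u i‖ - c * ‖v i‖) ^ 2 / (2 * c) := by positivity
  linarith

theorem IsHermitian.re_star_dotProduct_neg_I_smul_mulVec {H : Matrix n n ℂ}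
    (hH : H.IsHermitian) (v : n → ℂ) :
    (star v ⬝ᵥ ((-Complex.I) • H) *ᵥ v).re = 0 := by
  have h : (star v ⬝ᵥ H *ᵥ v).im = 0 := hH.im_star_dotProduct_mulVec_self v
  rw [smul_mulVec, dotProduct_smul]
  simp [h]

variable [DecidableEq n] {B : Matrix n n ℂ} {c : ℝ}

theorem isUnit_of_re_star_dotProduct_mulVec_eq (hc : 0 < c)
    (hB : ∀ v, (star v ⬝ᵥ B *ᵥ v).re = c * ∑ i, ‖v i‖ ^ 2) : IsUnit B := by
  rw [← mulVec_injective_iff_isUnit]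
  refine (injective_iff_map_eq_zero B.mulVecLin).2 fun v hv => ?_
  have hs : ∑ i, ‖v i‖ ^ 2 = 0 := by
    have h := hB v
    rw [← mulVecLin_apply, hv] at h
    simpa [hc.ne'] using h.symm
  rw [Finset.sum_eq_zero_iff_of_nonneg fun i _ => by positivity] at hs
  ext i
  simpa using hs i (Finset.mem_univ i)

theorem re_star_dotProduct_inv_mulVec_nonneg (hc : 0 < c)
    (hB : ∀ v, (star v ⬝ᵥ B *ᵥ v).re = c * ∑ i, ‖v i‖ ^ 2) (u : n → ℂ) :
    0 ≤ (star u ⬝ᵥ B⁻¹ *ᵥ u).re := by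
  have hdet := (isUnit_iff_isUnit_det B).1 (isUnit_of_re_star_dotProduct_mulVec_eq hc hB)
  set v := B⁻¹ *ᵥ u with hv
  have hu : u = B *ᵥ v := by rw [hv, mulVec_mulVec, mul_nonsing_inv _ hdet, one_mulVec]
  have h := hB v
  rw [← hu] at h
  have hconj : star u ⬝ᵥ v = star (star v ⬝ᵥ u) := star_dotProduct u v
  rw [hconj, Complex.star_def, Complex.conj_re, h]
  positivity

theorem sum_norm_sq_inv_mulVec_le (hc : 0 < c)
    (hB : ∀ v, (star v ⬝ᵥ B *ᵥ v).re = c * ∑ i, ‖v i‖ ^ 2) (w : n → ℂ) :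
    c * ∑ i, ‖(B⁻¹ *ᵥ w) i‖ ^ 2 ≤ (∑ i, ‖w i‖ ^ 2) / c := by
  have hdet := (isUnit_iff_isUnit_det B).1 (isUnit_of_re_star_dotProduct_mulVec_eq hc hB)
  set v := B⁻¹ *ᵥ w with hv
  have hw : w = B *ᵥ v := by rw [hv, mulVec_mulVec, mul_nonsing_inv _ hdet, one_mulVec]
  have h := hB v
  rw [← hw, dotProduct_comm] at h
  have hle := (Complex.re_le_norm _).trans (norm_dotProduct_le_of_pos w (star v) hc)
  simp only [Pi.star_apply, norm_star] at hle
  have hhalf : (∑ i, ‖w i‖ ^ 2) / (2 * c) = (∑ i, ‖w i‖ ^ 2) / c / 2 := by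
    field_simp
  linarith

theorem norm_dotProduct_inv_mulVec_le (hc : 0 < c)
    (hB : ∀ v, (star v ⬝ᵥ B *ᵥ v).re = c * ∑ i, ‖v i‖ ^ 2) {M : ℝ} {u w : n → ℂ}
    (hu : ∑ i, ‖u i‖ ^ 2 ≤ M) (hw : ∑ i, ‖w i‖ ^ 2 ≤ M) :
    ‖u ⬝ᵥ B⁻¹ *ᵥ w‖ ≤ M / c := by
  have h₁ := norm_dotProduct_le_of_pos u (B⁻¹ *ᵥ w) hc
  have h₂ := sum_norm_sq_inv_mulVec_le hc hB w
  have h₃ : (∑ i, ‖u i‖ ^ 2) / (2 * c) ≤ M / (2 * c) := by gcongr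
  have h₄ : (∑ i, ‖w i‖ ^ 2) / c ≤ M / c := by gcongr
  have h₅ : M / (2 * c) = M / c / 2 := by field_simp
  linarith

end Matrix

theorem dist1_comm {d : ℕ} (x y : Fin d → ℤ) : dist1 x y = dist1 y x :=
  Finset.sum_congr rfl fun i _ => abs_sub_comm (x i) (y i)

theorem card_filter_dist1_eq_one_le {d : ℕ} (Λ : Finset (Fin d → ℤ)) (j : Fin d → ℤ) :
    (Λ.filter fun k => dist1 j k = 1).card ≤ 3 ^ d := by
  have hsub : (Λ.filter fun k => dist1 j k = 1) ⊆
      Fintype.piFinset fun i => Finset.Icc (j i - 1) (j i + 1) := by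
    intro k hk
    have hk := (Finset.mem_filter.1 hk).2
    rw [Fintype.mem_piFinset]
    intro i
    have hi : |j i - k i| ≤ 1 := hk ▸ Finset.single_le_sum (f := fun i => |j i - k i|)
      (fun _ _ => abs_nonneg _) (Finset.mem_univ i)
    rw [abs_le] at hi
    rw [Finset.mem_Icc]
    omega
  refine (Finset.card_le_card hsub).trans_eq ?_
  have h : ∀ i, (j i + 1 + 1 - (j i - 1)).toNat = 3 := fun i => by omega
  simp [Fintype.card_piFinset, h]

theorem star_lapE {d : ℕ} (Λ : Finset (Fin d → ℤ)) (j k : Fin d → ℤ) :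
    star (lapE Λ j k) = lapE Λ k j := by
  rcases eq_or_ne j k with rfl | h
  · simp [lapE, apply_ite]
  · simp [lapE, apply_ite, dist1_comm j k, h, h.symm]

theorem norm_lapE_le {d : ℕ} (Λ : Finset (Fin d → ℤ)) (j k : Fin d → ℤ) :
    ‖lapE Λ j k‖ ≤ 1 + 3 ^ d := by
  refine (norm_sub_le _ _).trans (add_le_add ?_ ?_)
  · split_ifs <;> simp
  · split_ifs
    · rw [Complex.norm_natCast]
      exact_mod_cast card_filter_dist1_eq_one_le Λ j
    · simp

/-- The compression of `E + Δ` along a family of sites. -/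
def energyLap {d : ℕ} {ι : Type*} [DecidableEq ι] (Λ : Finset (Fin d → ℤ)) (E : ℝ)
    (s : ι → Fin d → ℤ) : Matrix ι ι ℂ := fun a b =>
  (if a = b then (E : ℂ) else 0) + lapE Λ (s a) (s b)

theorem isHermitian_energyLap {d : ℕ} {ι : Type*} [DecidableEq ι] (Λ : Finset (Fin d → ℤ))
    (E : ℝ) (s : ι → Fin d → ℤ) : (energyLap Λ E s).IsHermitian := by
  ext a b
  rw [conjTranspose_apply, energyLap, energyLap, star_add, star_lapE]
  rcases eq_or_ne a b with rfl | h
  · simp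
  · simp [h, h.symm]

theorem A0mat_eq {d : ℕ} (Λ : Finset (Fin d → ℤ)) (i₁ i₂ : Fin d → ℤ) (E : ℝ) :
    A0mat Λ i₁ i₂ E = (-Complex.I) • energyLap Λ E ![i₁, i₂] := rfl

theorem norm_A0mat_le {d : ℕ} (Λ : Finset (Fin d → ℤ)) (i₁ i₂ : Fin d → ℤ) (E : ℝ)
    (a b : Fin 2) : ‖A0mat Λ i₁ i₂ E a b‖ ≤ |E| + (1 + 3 ^ d) := by
  rw [A0mat, norm_mul, norm_neg, Complex.norm_I, one_mul]
  refine (norm_add_le _ _).trans (add_le_add ?_ (norm_lapE_le _ _ _))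
  split_ifs <;> simp

theorem Bmat_eq {d : ℕ} (Λ : Finset (Fin d → ℤ)) (i₁ i₂ : Fin d → ℤ) (E lam : ℝ) :
    Bmat Λ i₁ i₂ E lam =
      (lam : ℂ) • (1 : Matrix _ _ ℂ) + (-Complex.I) • energyLap Λ E Subtype.val := by
  ext j k
  simp [Bmat, energyLap, Matrix.one_apply, sub_eq_add_neg]

theorem re_star_dotProduct_Bmat_mulVec {d : ℕ} (Λ : Finset (Fin d → ℤ)) (i₁ i₂ : Fin d → ℤ)
    (E lam : ℝ) (v : ((Λ.erase i₁).erase i₂) → ℂ) :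
    (star v ⬝ᵥ Bmat Λ i₁ i₂ E lam *ᵥ v).re = lam * ∑ i, ‖v i‖ ^ 2 := by
  rw [Bmat_eq, add_mulVec, dotProduct_add, Complex.add_re,
    (isHermitian_energyLap Λ E _).re_star_dotProduct_neg_I_smul_mulVec, smul_mulVec,
    one_mulVec, dotProduct_smul, star_dotProduct_self_eq_sum_norm_sq, smul_eq_mul,
    ← Complex.ofReal_mul, Complex.ofReal_re, add_zero]

theorem star_Dmat {d : ℕ} (Λ : Finset (Fin d → ℤ)) (i₁ i₂ : Fin d → ℤ) :
    (Dmat Λ i₁ i₂)ᴴ = (Dmat Λ i₁ i₂)ᵀ := by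
  ext a b
  simp [Dmat, apply_ite]

theorem sum_norm_sq_Dmat_le {d : ℕ} (Λ : Finset (Fin d → ℤ)) (i₁ i₂ : Fin d → ℤ) (a : Fin 2) :
    ∑ k, ‖Dmat Λ i₁ i₂ a k‖ ^ 2 ≤ 3 ^ d := by
  have h : ∀ k, ‖Dmat Λ i₁ i₂ a k‖ ^ 2 =
      if dist1 (![i₁, i₂] a) (k : Fin d → ℤ) = 1 then (1 : ℝ) else 0 := fun k => by
    unfold Dmat
    split_ifs <;> simp
  rw [Finset.sum_congr rfl fun k _ => h k,
    Finset.sum_coe_sort ((Λ.erase i₁).erase i₂)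
      fun k => if dist1 (![i₁, i₂] a) k = 1 then (1 : ℝ) else 0, Finset.sum_boole]
  exact_mod_cast card_filter_dist1_eq_one_le _ _

theorem re_star_dotProduct_Spp_mulVec_ge {d : ℕ} (Λ : Finset (Fin d → ℤ))
    (i₁ i₂ : Fin d → ℤ) (E δ : ℝ) {lam : ℝ} (hlam : 0 < lam) (f : Fin 2 → ℂ) :
    lam * (1 - δ ^ 2) * ∑ j, ‖f j‖ ^ 2 ≤ (star f ⬝ᵥ Spp Λ i₁ i₂ E lam δ *ᵥ f).re := by
  have hcoup : star f ⬝ᵥ (Dmat Λ i₁ i₂ * (Bmat Λ i₁ i₂ E lam)⁻¹ * (Dmat Λ i₁ i₂)ᵀ) *ᵥ f =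
      star ((Dmat Λ i₁ i₂)ᵀ *ᵥ f) ⬝ᵥ
        (Bmat Λ i₁ i₂ E lam)⁻¹ *ᵥ ((Dmat Λ i₁ i₂)ᵀ *ᵥ f) := by
    rw [← star_Dmat, star_mulVec, conjTranspose_conjTranspose, ← mulVec_mulVec,
      ← mulVec_mulVec, dotProduct_mulVec]
  have hnonneg := re_star_dotProduct_inv_mulVec_nonneg hlam
    (re_star_dotProduct_Bmat_mulVec Λ i₁ i₂ E lam) ((Dmat Λ i₁ i₂)ᵀ *ᵥ f)
  have hdiag : ((lam : ℂ) * (1 - (δ : ℂ) ^ 2)) * ((∑ j, ‖f j‖ ^ 2 : ℝ) : ℂ) =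
      ((lam * (1 - δ ^ 2) * ∑ j, ‖f j‖ ^ 2 : ℝ) : ℂ) := by
    push_cast
    rfl
  rw [Spp, add_mulVec, add_mulVec, dotProduct_add, dotProduct_add, Complex.add_re,
    Complex.add_re, A0mat_eq,
    (isHermitian_energyLap Λ E _).re_star_dotProduct_neg_I_smul_mulVec, smul_mulVec,
    one_mulVec, dotProduct_smul, star_dotProduct_self_eq_sum_norm_sq, smul_eq_mul, hdiag,
    Complex.ofReal_re, hcoup]
  linarith

theorem norm_Spp_apply_le {d : ℕ} (Λ : Finset (Fin d → ℤ)) (i₁ i₂ : Fin d → ℤ) (E : ℝ)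
    {lam δ : ℝ} (hlam : 0 < lam) (hδ : δ ^ 2 ≤ 1) (a b : Fin 2) :
    ‖Spp Λ i₁ i₂ E lam δ a b‖ ≤ |E| + (1 + 3 ^ d) + lam + 3 ^ d / lam := by
  rw [Spp, Matrix.add_apply, Matrix.add_apply]
  refine (norm_add₃_le).trans (add_le_add_three (norm_A0mat_le Λ i₁ i₂ E a b) ?_ ?_)
  · have hnorm : ‖(lam : ℂ) * (1 - (δ : ℂ) ^ 2)‖ ≤ lam := by
      have h : (lam : ℂ) * (1 - (δ : ℂ) ^ 2) = ((lam * (1 - δ ^ 2) : ℝ) : ℂ) := by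
        push_cast
        rfl
      rw [h, Complex.norm_real, Real.norm_of_nonneg (mul_nonneg hlam.le (by linarith))]
      nlinarith [sq_nonneg δ]
    rw [Matrix.smul_apply, Matrix.one_apply]
    split_ifs
    · simpa using hnorm
    · simpa using hlam.le
  · have h : (Dmat Λ i₁ i₂ * (Bmat Λ i₁ i₂ E lam)⁻¹ * (Dmat Λ i₁ i₂)ᵀ) a b =
        Dmat Λ i₁ i₂ a ⬝ᵥ (Bmat Λ i₁ i₂ E lam)⁻¹ *ᵥ Dmat Λ i₁ i₂ b := by
      rw [Matrix.mul_assoc]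
      rfl
    rw [h]
    exact norm_dotProduct_inv_mulVec_le hlam (re_star_dotProduct_Bmat_mulVec Λ i₁ i₂ E lam)
      (sum_norm_sq_Dmat_le Λ i₁ i₂ a) (sum_norm_sq_Dmat_le Λ i₁ i₂ b)

/-- Lemma 4.2(iii). The Schur complement `S_{++}` satisfies
`Re⟨f, S_{++}f⟩ ≥ (λ/2)‖f‖²` for all `f ∈ ℂ²`, and there is `K > 0` depending only on
`d` and `E` with `|(S_{++})_{jk}| ≤ K(λ + 1/λ)`. -/
theorem schur_complement_bounds (d : ℕ) (hd : 1 ≤ d) (E : ℝ) :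
    ∃ K : ℝ, 0 < K ∧
      ∀ (i₁ i₂ : Fin d → ℤ), dist1 i₁ i₂ = 1 →
      ∀ (L : ℕ), i₁ ∈ cube d L → i₂ ∈ cube d L →
      ∀ (lam : ℝ), 0 < lam →
      ∀ (δ : ℝ), 0 < δ → δ ≤ 1 / 2 →
      (∀ f : Fin 2 → ℂ,
        lam / 2 * ∑ j, ‖f j‖ ^ 2 ≤
          (star f ⬝ᵥ (Spp (cube d L) i₁ i₂ E lam δ *ᵥ f)).re) ∧
      (∀ a b : Fin 2,
        ‖Spp (cube d L) i₁ i₂ E lam δ a b‖ ≤ K * (lam + 1 / lam)) := by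
  refine ⟨|E| + (1 + 3 ^ d) + 1 + 3 ^ d, by positivity, fun i₁ i₂ _ L _ _ lam hlam δ hδ₀ hδ =>
    ⟨fun f => ?_, fun a b => ?_⟩⟩
  · refine le_trans ?_ (re_star_dotProduct_Spp_mulVec_ge _ i₁ i₂ E δ hlam f)
    have hsq : δ ^ 2 ≤ 1 / 2 := by nlinarith
    gcongr
    nlinarith
  · refine (norm_Spp_apply_le _ i₁ i₂ E hlam (by nlinarith) a b).trans ?_
    have hone : 1 ≤ lam + 1 / lam := by
      rcases le_total 1 lam with h | h
      · have : 0 < 1 / lam := by positivity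
        linarith
      · have : 1 ≤ 1 / lam := (one_le_div hlam).2 h
        linarith
    have hinv : 0 < 1 / lam := by positivity
    have hpow : (1 : ℝ) ≤ 3 ^ d := one_le_pow₀ (by norm_num)
    have hdiv : (3 : ℝ) ^ d / lam = 3 ^ d * (1 / lam) := by ring
    have hE := abs_nonneg E
    rw [hdiv]
    nlinarith [mul_le_mul_of_nonneg_left hone (by positivity : 0 ≤ |E| + (1 + (3 : ℝ) ^ d)),
      mul_pos (zero_lt_one.trans_le hpow) hlam]
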